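/- Let x̄ ∈ F be a locally optimal solution of (MPSC) and assume that MPSC-PCRSC holds at x̄. Then the penalty problem admits a local exact penalization at x̄: there exists κ̄ > 0 such that for every κ > κ̄, x̄ is a local minimizer of the penalty function P_κ, i.e., there exists ε' > 0 with P_κ(x̄) ≤ P_κ(x) for all x with ‖x − x̄‖ < ε'. -/

import Mathlib

open Set Filter Topology Metric

noncomputable section

namespace MPSC

abbrev Vec (n : ℕ) := EuclideanSpace ℝ (Fin n)

variable {n m p l : ℕ}

open scoped Classical in
/-- Sum of a function over an index set (finite ambient type). -/
noncomputable def sumOver {α β : Type*} [Fintype α] [AddCommMonoid β]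
    (S : Set α) (v : α → β) : β :=
  ∑ a, if a ∈ S then v a else 0

/-- The feasible set of (MPSC). -/
def Feas (g : Fin m → Vec n → ℝ) (h : Fin p → Vec n → ℝ)
    (G H : Fin l → Vec n → ℝ) : Set (Vec n) :=
  {x | (∀ i, g i x ≤ 0) ∧ (∀ j, h j x = 0) ∧ ∀ k, G k x * H k x = 0}

/-- Index set of active inequality constraints. -/
def Ig (g : Fin m → Vec n → ℝ) (xb : Vec n) : Set (Fin m) := {i | g i xb = 0}

def IG (G H : Fin l → Vec n → ℝ) (xb : Vec n) : Set (Fin l) :=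
  {k | G k xb = 0 ∧ H k xb ≠ 0}

def IH (G H : Fin l → Vec n → ℝ) (xb : Vec n) : Set (Fin l) :=
  {k | G k xb ≠ 0 ∧ H k xb = 0}

def IGH (G H : Fin l → Vec n → ℝ) (xb : Vec n) : Set (Fin l) :=
  {k | G k xb = 0 ∧ H k xb = 0}

/-- (β1, β2) is a disjoint bipartition of I_GH. -/
def Partition (G H : Fin l → Vec n → ℝ) (xb : Vec n) (β1 β2 : Set (Fin l)) : Prop :=
  β1 ∩ β2 = ∅ ∧ β1 ∪ β2 = IGH G H xb

/-- Branch feasible set. -/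
def BranchFeas (g : Fin m → Vec n → ℝ) (h : Fin p → Vec n → ℝ)
    (G H : Fin l → Vec n → ℝ) (xb : Vec n) (β1 β2 : Set (Fin l)) : Set (Vec n) :=
  {x | (∀ i, g i x ≤ 0) ∧ (∀ j, h j x = 0) ∧
    (∀ k ∈ IG G H xb ∪ β1, G k x = 0) ∧ ∀ k ∈ IH G H xb ∪ β2, H k x = 0}

/-- Bouligand tangent cone, as defined in the paper. -/
def tangentCone (Ω : Set (Vec n)) (xb : Vec n) : Set (Vec n) :=
  {d | ∃ t : ℕ → ℝ, ∃ x : ℕ → Vec n, (∀ k, 0 ≤ t k) ∧ (∀ k, x k ∈ Ω) ∧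
    Tendsto x atTop (nhds xb) ∧ Tendsto (fun k => t k • (x k - xb)) atTop (nhds d)}

/-- MPSC linearization cone. -/
def LCone (g : Fin m → Vec n → ℝ) (h : Fin p → Vec n → ℝ)
    (G H : Fin l → Vec n → ℝ) (xb : Vec n) : Set (Vec n) :=
  {d | (∀ i ∈ Ig g xb, fderiv ℝ (g i) xb d ≤ 0) ∧ (∀ j, fderiv ℝ (h j) xb d = 0) ∧
    (∀ k ∈ IG G H xb, fderiv ℝ (G k) xb d = 0) ∧ (∀ k ∈ IH G H xb, fderiv ℝ (H k) xb d = 0) ∧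
    ∀ k ∈ IGH G H xb, fderiv ℝ (G k) xb d * fderiv ℝ (H k) xb d = 0}

/-- Branch linearization cone. -/
def BranchLCone (g : Fin m → Vec n → ℝ) (h : Fin p → Vec n → ℝ)
    (G H : Fin l → Vec n → ℝ) (xb : Vec n) (β1 β2 : Set (Fin l)) : Set (Vec n) :=
  {d | (∀ i ∈ Ig g xb, fderiv ℝ (g i) xb d ≤ 0) ∧ (∀ j, fderiv ℝ (h j) xb d = 0) ∧
    (∀ k ∈ IG G H xb ∪ β1, fderiv ℝ (G k) xb d = 0) ∧
    ∀ k ∈ IH G H xb ∪ β2, fderiv ℝ (H k) xb d = 0}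

/-- MPSC critical subspace. -/
def CritSubspace (g : Fin m → Vec n → ℝ) (h : Fin p → Vec n → ℝ)
    (G H : Fin l → Vec n → ℝ) (xb : Vec n) : Set (Vec n) :=
  {d | (∀ i ∈ Ig g xb, fderiv ℝ (g i) xb d = 0) ∧ (∀ j, fderiv ℝ (h j) xb d = 0) ∧
    (∀ k ∈ IG G H xb ∪ IGH G H xb, fderiv ℝ (G k) xb d = 0) ∧
    ∀ k ∈ IH G H xb ∪ IGH G H xb, fderiv ℝ (H k) xb d = 0}

/-- Rank (dimension of the span) of the family of gradients
{∇g_i(x)}_{i∈I1} ∪ {∇h_j(x)}_j ∪ {∇G_k(x)}_{k∈I3} ∪ {∇H_k(x)}_{k∈I4}. -/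
def gradRank (g : Fin m → Vec n → ℝ) (h : Fin p → Vec n → ℝ)
    (G H : Fin l → Vec n → ℝ) (I1 : Set (Fin m)) (I3 I4 : Set (Fin l)) (x : Vec n) : ℕ :=
  Module.finrank ℝ ↥(Submodule.span ℝ
    ((fun i => gradient (g i) x) '' I1 ∪ Set.range (fun j => gradient (h j) x) ∪
     (fun k => gradient (G k) x) '' I3 ∪ (fun k => gradient (H k) x) '' I4))

/-- MPSC-LICQ. -/
def LICQ (g : Fin m → Vec n → ℝ) (h : Fin p → Vec n → ℝ)
    (G H : Fin l → Vec n → ℝ) (xb : Vec n) : Prop :=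
  ∀ (lam : Fin m → ℝ) (ρ : Fin p → ℝ) (μ ν : Fin l → ℝ),
    (∀ i, i ∉ Ig g xb → lam i = 0) →
    (∀ k, k ∉ IG G H xb ∪ IGH G H xb → μ k = 0) →
    (∀ k, k ∉ IH G H xb ∪ IGH G H xb → ν k = 0) →
    ∑ i, lam i • gradient (g i) xb + ∑ j, ρ j • gradient (h j) xb +
      ∑ k, μ k • gradient (G k) xb + ∑ k, ν k • gradient (H k) xb = 0 →
    lam = 0 ∧ ρ = 0 ∧ μ = 0 ∧ ν = 0

/-- MPSC-RCRCQ. -/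
def RCRCQ (g : Fin m → Vec n → ℝ) (h : Fin p → Vec n → ℝ)
    (G H : Fin l → Vec n → ℝ) (xb : Vec n) : Prop :=
  ∃ ε > (0:ℝ), ∀ I1 : Set (Fin m), I1 ⊆ Ig g xb →
    ∀ I3 I4 : Set (Fin l), I3 ⊆ IGH G H xb → I4 ⊆ IGH G H xb →
      ∀ x : Vec n, ‖x - xb‖ < ε →
        gradRank g h G H I1 (I3 ∪ IG G H xb) (I4 ∪ IH G H xb) x =
        gradRank g h G H I1 (I3 ∪ IG G H xb) (I4 ∪ IH G H xb) xb

/-- MPSC-WCR. -/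
def WCR (g : Fin m → Vec n → ℝ) (h : Fin p → Vec n → ℝ)
    (G H : Fin l → Vec n → ℝ) (xb : Vec n) : Prop :=
  ∃ ε > (0:ℝ), ∀ x : Vec n, ‖x - xb‖ < ε →
    gradRank g h G H (Ig g xb) (IG G H xb ∪ IGH G H xb) (IH G H xb ∪ IGH G H xb) x =
    gradRank g h G H (Ig g xb) (IG G H xb ∪ IGH G H xb) (IH G H xb ∪ IGH G H xb) xb

/-- MPSC-PWCR. -/
def PWCR (g : Fin m → Vec n → ℝ) (h : Fin p → Vec n → ℝ)
    (G H : Fin l → Vec n → ℝ) (xb : Vec n) : Prop :=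
  ∀ β1 β2 : Set (Fin l), Partition G H xb β1 β2 →
    ∃ ε > (0:ℝ), ∀ x : Vec n, ‖x - xb‖ < ε →
      gradRank g h G H (Ig g xb) (IG G H xb ∪ β1) (IH G H xb ∪ β2) x =
      gradRank g h G H (Ig g xb) (IG G H xb ∪ β1) (IH G H xb ∪ β2) xb

/-- The index set I_g^- associated with a branch (β1, β2). -/
def IgMinus (g : Fin m → Vec n → ℝ) (h : Fin p → Vec n → ℝ)
    (G H : Fin l → Vec n → ℝ) (xb : Vec n) (β1 β2 : Set (Fin l)) : Set (Fin m) :=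
  {i | i ∈ Ig g xb ∧ ∃ (lam : Fin m → ℝ) (ρ : Fin p → ℝ) (μ ν : Fin l → ℝ),
    (∀ i', 0 ≤ lam i') ∧ (∀ i', i' ∉ Ig g xb \ {i} → lam i' = 0) ∧
    (∀ k, k ∉ IG G H xb ∪ β1 → μ k = 0) ∧ (∀ k, k ∉ IH G H xb ∪ β2 → ν k = 0) ∧
    -gradient (g i) xb = ∑ i', lam i' • gradient (g i') xb + ∑ j, ρ j • gradient (h j) xb +
      ∑ k, μ k • gradient (G k) xb + ∑ k, ν k • gradient (H k) xb}

/-- MPSC-PCRSC. -/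
def PCRSC (g : Fin m → Vec n → ℝ) (h : Fin p → Vec n → ℝ)
    (G H : Fin l → Vec n → ℝ) (xb : Vec n) : Prop :=
  ∀ β1 β2 : Set (Fin l), Partition G H xb β1 β2 →
    ∃ ε > (0:ℝ), ∀ x : Vec n, ‖x - xb‖ < ε →
      gradRank g h G H (IgMinus g h G H xb β1 β2) (IG G H xb ∪ β1) (IH G H xb ∪ β2) x =
      gradRank g h G H (IgMinus g h G H xb β1 β2) (IG G H xb ∪ β1) (IH G H xb ∪ β2) xb

/-- A twice differentiable arc on [0, δ) (one-sided at the endpoint 0),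
with first derivative ξ'. -/
def TwiceDiffArc (δ : ℝ) (ξ ξ' : ℝ → Vec n) : Prop :=
  (∀ t ∈ Ico (0:ℝ) δ, HasDerivWithinAt ξ (ξ' t) (Ico (0:ℝ) δ) t) ∧
  ∀ t ∈ Ico (0:ℝ) δ, DifferentiableWithinAt ℝ ξ' (Ico (0:ℝ) δ) t

/-- MPSC-SSOCQ. -/
def SSOCQ (g : Fin m → Vec n → ℝ) (h : Fin p → Vec n → ℝ)
    (G H : Fin l → Vec n → ℝ) (xb : Vec n) : Prop :=
  ∀ d ∈ LCone g h G H xb, d ≠ 0 →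
    ∃ δ > (0:ℝ), ∃ J K : Set (Fin l), J ⊆ IGH G H xb ∧ K ⊆ IGH G H xb ∧
      ∃ ξ ξ' : ℝ → Vec n, TwiceDiffArc δ ξ ξ' ∧
        (∀ t ∈ Ico (0:ℝ) δ, ξ t ∈ Feas g h G H) ∧
        ξ 0 = xb ∧ ξ' 0 = d ∧
        (∀ t ∈ Ico (0:ℝ) δ, ∀ i ∈ Ig g xb, fderiv ℝ (g i) xb d = 0 → g i (ξ t) = 0) ∧
        (∀ t ∈ Ico (0:ℝ) δ, ∀ k ∈ IG G H xb ∪ J, G k (ξ t) = 0) ∧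
        ∀ t ∈ Ico (0:ℝ) δ, ∀ k ∈ IH G H xb ∪ K, H k (ξ t) = 0

/-- MPSC-WSOCQ. -/
def WSOCQ (g : Fin m → Vec n → ℝ) (h : Fin p → Vec n → ℝ)
    (G H : Fin l → Vec n → ℝ) (xb : Vec n) : Prop :=
  ∀ d ∈ CritSubspace g h G H xb, d ≠ 0 →
    ∃ δ > (0:ℝ), ∃ J K : Set (Fin l), J ⊆ IGH G H xb ∧ K ⊆ IGH G H xb ∧
      ∃ ζ ζ' : ℝ → Vec n, TwiceDiffArc δ ζ ζ' ∧
        (∀ t ∈ Ico (0:ℝ) δ, ζ t ∈ Feas g h G H) ∧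
        ζ 0 = xb ∧ ζ' 0 = d ∧
        (∀ t ∈ Ico (0:ℝ) δ, ∀ i ∈ Ig g xb, g i (ζ t) = 0) ∧
        (∀ t ∈ Ico (0:ℝ) δ, ∀ k ∈ IG G H xb ∪ J, G k (ζ t) = 0) ∧
        ∀ t ∈ Ico (0:ℝ) δ, ∀ k ∈ IH G H xb ∪ K, H k (ζ t) = 0

/-- The S-stationarity system for multipliers (λ, ρ, μ, ν) at xb. -/
def SStationarySystem (f : Vec n → ℝ) (g : Fin m → Vec n → ℝ) (h : Fin p → Vec n → ℝ)
    (G H : Fin l → Vec n → ℝ) (xb : Vec n)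
    (lam : Fin m → ℝ) (ρ : Fin p → ℝ) (μ ν : Fin l → ℝ) : Prop :=
  (∀ i, 0 ≤ lam i) ∧ (∀ i, lam i * g i xb = 0) ∧
  (∀ k ∈ IH G H xb ∪ IGH G H xb, μ k = 0) ∧
  (∀ k ∈ IG G H xb ∪ IGH G H xb, ν k = 0) ∧
  gradient f xb + ∑ i, lam i • gradient (g i) xb + ∑ j, ρ j • gradient (h j) xb +
    ∑ k, μ k • gradient (G k) xb + ∑ k, ν k • gradient (H k) xb = 0

def SStationary (f : Vec n → ℝ) (g : Fin m → Vec n → ℝ) (h : Fin p → Vec n → ℝ)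
    (G H : Fin l → Vec n → ℝ) (xb : Vec n) : Prop :=
  ∃ (lam : Fin m → ℝ) (ρ : Fin p → ℝ) (μ ν : Fin l → ℝ),
    SStationarySystem f g h G H xb lam ρ μ ν

/-- The M-stationarity system for multipliers (λ, ρ, μ, ν) at xb. -/
def MStationarySystem (f : Vec n → ℝ) (g : Fin m → Vec n → ℝ) (h : Fin p → Vec n → ℝ)
    (G H : Fin l → Vec n → ℝ) (xb : Vec n)
    (lam : Fin m → ℝ) (ρ : Fin p → ℝ) (μ ν : Fin l → ℝ) : Prop :=
  (∀ i, 0 ≤ lam i) ∧ (∀ i, lam i * g i xb = 0) ∧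
  (∀ k ∈ IH G H xb, μ k = 0) ∧ (∀ k ∈ IG G H xb, ν k = 0) ∧
  (∀ k ∈ IGH G H xb, μ k * ν k = 0) ∧
  gradient f xb + ∑ i, lam i • gradient (g i) xb + ∑ j, ρ j • gradient (h j) xb +
    ∑ k, μ k • gradient (G k) xb + ∑ k, ν k • gradient (H k) xb = 0

def MStationary (f : Vec n → ℝ) (g : Fin m → Vec n → ℝ) (h : Fin p → Vec n → ℝ)
    (G H : Fin l → Vec n → ℝ) (xb : Vec n) : Prop :=
  ∃ (lam : Fin m → ℝ) (ρ : Fin p → ℝ) (μ ν : Fin l → ℝ),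
    MStationarySystem f g h G H xb lam ρ μ ν

/-- Local optimality for (MPSC). -/
def LocallyOptimal (f : Vec n → ℝ) (g : Fin m → Vec n → ℝ) (h : Fin p → Vec n → ℝ)
    (G H : Fin l → Vec n → ℝ) (xb : Vec n) : Prop :=
  xb ∈ Feas g h G H ∧ ∃ ε > (0:ℝ), ∀ x ∈ Feas g h G H, ‖x - xb‖ < ε → f xb ≤ f x

/-- Hessian quadratic form dᵀ∇²φ(x)d. -/
def hessForm (φ : Vec n → ℝ) (x d : Vec n) : ℝ :=
  iteratedFDeriv ℝ 2 φ x ![d, d]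

/-- The Lagrange function ℓ. -/
def lagr (f : Vec n → ℝ) (g : Fin m → Vec n → ℝ) (h : Fin p → Vec n → ℝ)
    (G H : Fin l → Vec n → ℝ)
    (lam : Fin m → ℝ) (ρ : Fin p → ℝ) (μ ν : Fin l → ℝ) : Vec n → ℝ :=
  fun x => f x + ∑ i, lam i * g i x + ∑ j, ρ j * h j x +
    ∑ k, μ k * G k x + ∑ k, ν k * H k x

/-- Constraint-violation residual. -/
def residual (g : Fin m → Vec n → ℝ) (h : Fin p → Vec n → ℝ)
    (G H : Fin l → Vec n → ℝ) (x : Vec n) : ℝ :=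
  Real.sqrt (∑ i, max (g i x) 0 ^ 2 + ∑ j, h j x ^ 2 + ∑ k, min (G k x ^ 2) (H k x ^ 2))

/-- Penalty function P_κ. -/
def Pen (f : Vec n → ℝ) (g : Fin m → Vec n → ℝ) (h : Fin p → Vec n → ℝ)
    (G H : Fin l → Vec n → ℝ) (κ : ℝ) (x : Vec n) : ℝ :=
  f x + κ * residual g h G H x

/-- MPSC piecewise second-order quasi-normality. -/
def PSOQN (g : Fin m → Vec n → ℝ) (h : Fin p → Vec n → ℝ)
    (G H : Fin l → Vec n → ℝ) (xb : Vec n) : Prop :=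
  ∀ β1 β2 : Set (Fin l), Partition G H xb β1 β2 →
    ¬ ∃ (lam : Fin m → ℝ) (ρ : Fin p → ℝ) (μ ν : Fin l → ℝ),
      (∀ i, 0 ≤ lam i) ∧
      (∀ k, k ∉ IG G H xb ∪ β1 → μ k = 0) ∧ (∀ k, k ∉ IH G H xb ∪ β2 → ν k = 0) ∧
      ¬(lam = 0 ∧ ρ = 0 ∧ μ = 0 ∧ ν = 0) ∧
      (∑ i, lam i • gradient (g i) xb + ∑ j, ρ j • gradient (h j) xb +
        ∑ k, μ k • gradient (G k) xb + ∑ k, ν k • gradient (H k) xb = 0) ∧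
      (∀ d : Vec n, (∀ i ∈ Ig g xb, fderiv ℝ (g i) xb d = 0) →
        (∀ j, fderiv ℝ (h j) xb d = 0) →
        (∀ k ∈ IG G H xb ∪ β1, fderiv ℝ (G k) xb d = 0) →
        (∀ k ∈ IH G H xb ∪ β2, fderiv ℝ (H k) xb d = 0) →
        0 ≤ ∑ i, lam i * hessForm (g i) xb d + ∑ j, ρ j * hessForm (h j) xb d +
          ∑ k, μ k * hessForm (G k) xb d + ∑ k, ν k * hessForm (H k) xb d) ∧
      ∃ xs : ℕ → Vec n, Tendsto xs atTop (nhds xb) ∧ ∀ s,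
        (∀ i, 0 < lam i → 0 < lam i * g i (xs s)) ∧
        (∀ j, ρ j ≠ 0 → 0 < ρ j * h j (xs s)) ∧
        (∀ k, μ k ≠ 0 → 0 < μ k * G k (xs s)) ∧
        (∀ k, ν k ≠ 0 → 0 < ν k * H k (xs s))

/-- Farkas' lemma for finitely many vectors. -/
theorem exists_nonneg_combination_of_forall_inner_nonpos {E κ : Type*} [NormedAddCommGroup E]
    [InnerProductSpace ℝ E] (s : Finset κ) (a : κ → E) (b : E)
    (hab : ∀ x, (∀ i ∈ s, inner ℝ (a i) x ≤ 0) → inner ℝ b x ≤ 0) :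
    ∃ c : κ → ℝ, (∀ i, 0 ≤ c i) ∧ b = ∑ i ∈ s, c i • a i := by
  classical
  induction s using Finset.induction_on generalizing a b with
  | empty =>
    refine ⟨0, fun _ => le_rfl, ?_⟩
    have := hab b (by simp)
    simpa using real_inner_self_nonpos.1 this
  | insert j s hj ih =>
    by_cases hs : ∀ x, (∀ i ∈ s, inner ℝ (a i) x ≤ 0) → inner ℝ b x ≤ 0
    · obtain ⟨c, hc, hb⟩ := ih a b hs
      refine ⟨Function.update c j 0, fun i => ?_, ?_⟩
      · by_cases hi : i = j
        · simp [hi]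
        · simpa [hi] using hc i
      · rw [Finset.sum_insert hj, hb]
        simp only [Function.update_self, zero_smul, zero_add]
        refine Finset.sum_congr rfl fun i hi => ?_
        rw [Function.update_of_ne (ne_of_mem_of_not_mem hi hj)]
    · push Not at hs
      obtain ⟨y, hy, hby⟩ := hs
      have hjy : 0 < inner ℝ (a j) y := by
        by_contra! hle
        refine absurd (hab y fun i hi => ?_) (not_le.2 hby)
        rcases Finset.mem_insert.1 hi with rfl | hi
        exacts [hle, hy i hi]
      set α := inner ℝ (a j) y with hα
      obtain ⟨c, hc, hb⟩ := ih (fun i => a i - (inner ℝ (a i) y / α) • a j)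
        (b - (inner ℝ b y / α) • a j) (by
          intro x hx
          have key : ∀ v : E, inner ℝ (v - (inner ℝ v y / α) • a j) x =
              inner ℝ v (x - (inner ℝ (a j) x / α) • y) := by
            intro v
            simp only [inner_sub_left, inner_sub_right, real_inner_smul_left,
              real_inner_smul_right]
            ring
          rw [key]
          refine hab _ fun i hi => ?_
          rcases Finset.mem_insert.1 hi with rfl | hi
          · simp only [inner_sub_right, real_inner_smul_right, ← hα]
            rw [div_mul_cancel₀ _ hjy.ne', sub_self]
          · rw [← key]
            exact hx i hi)
      set γ := inner ℝ b y / α - ∑ i ∈ s, c i * (inner ℝ (a i) y / α) with hγ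
      have hγ0 : 0 ≤ γ := by
        have h1 : 0 ≤ inner ℝ b y / α := by positivity
        have h2 : ∑ i ∈ s, c i * (inner ℝ (a i) y / α) ≤ 0 :=
          Finset.sum_nonpos fun i hi => mul_nonpos_of_nonneg_of_nonpos (hc i)
            (div_nonpos_of_nonpos_of_nonneg (hy i hi) hjy.le)
        linarith
      refine ⟨Function.update c j γ, fun i => ?_, ?_⟩
      · by_cases hi : i = j
        · simpa [hi] using hγ0
        · simpa [hi] using hc i
      · rw [Finset.sum_insert hj, Function.update_self]
        have h3 : ∑ i ∈ s, Function.update c j γ i • a i = ∑ i ∈ s, c i • a i :=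
          Finset.sum_congr rfl fun i hi => by
            rw [Function.update_of_ne (ne_of_mem_of_not_mem hi hj)]
        rw [h3, hγ, sub_smul, Finset.sum_smul]
        rw [sub_eq_iff_eq_add] at hb
        conv_lhs => rw [hb]
        simp only [smul_sub, Finset.sum_sub_distrib, smul_smul]
        abel

theorem exists_biorthogonal {E β : Type*} [NormedAddCommGroup E]
    [InnerProductSpace ℝ E] [FiniteDimensional ℝ E] [Fintype β] [DecidableEq β] {v : β → E}
    (hv : LinearIndependent ℝ v) :
    ∃ w : β → E, ∀ i j, inner ℝ (v i) (w j) = if i = j then (1 : ℝ) else 0 := by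
  obtain ⟨L, hL⟩ := LinearMap.exists_leftInverse_of_injective (Fintype.linearCombination ℝ v)
    (LinearMap.ker_eq_bot.2 hv.fintypeLinearCombination_injective)
  refine ⟨fun j => (InnerProductSpace.toDual ℝ E).symm
    (LinearMap.toContinuousLinearMap (LinearMap.proj j ∘ₗ L)), fun i j => ?_⟩
  rw [real_inner_comm, InnerProductSpace.toDual_symm_apply]
  have := congrFun (LinearMap.congr_fun hL (Pi.single i 1)) j
  simpa [Fintype.linearCombination_apply_single, Pi.single_apply, eq_comm] using this

/-- A chart near `x₀` in which the functions `φ k` become the linear functionals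
`fderiv ℝ (φ k) x₀`, provided `w` is biorthogonal to these. -/
def straighten {E β : Type*} [NormedAddCommGroup E] [InnerProductSpace ℝ E]
    [Fintype β] (φ : β → E → ℝ) (x₀ : E) (w : β → E) (x : E) : E :=
  x + ∑ k, (φ k x - fderiv ℝ (φ k) x₀ x) • w k

section Straighten

variable {E β : Type*} [NormedAddCommGroup E] [InnerProductSpace ℝ E]
  {φ : β → E → ℝ} {x₀ : E} {w : β → E}

theorem hasStrictFDerivAt_of_contDiff_one {ψ : E → ℝ} (hψ : ContDiff ℝ 1 ψ) (x : E) :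
    HasStrictFDerivAt ψ (fderiv ℝ ψ x) x :=
  hψ.contDiffAt.hasStrictFDerivAt one_ne_zero

/-- A function whose gradient lies near `x₀` in the span of the gradients of the `φ k` is, in the
straightened chart, constant along the common kernel of the linearized `φ k`. -/
theorem eventually_eq_of_gradient_mem_span [FiniteDimensional ℝ E]
    (hφ : ∀ k, ContDiff ℝ 1 (φ k))
    {T : E → E} {y₀ : E} (hT : ContDiffAt ℝ 1 T y₀) (hT₀ : T y₀ = x₀)
    (hφT : ∀ᶠ y in 𝓝 y₀, ∀ k, φ k (T y) = fderiv ℝ (φ k) x₀ y)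
    {ψ : E → ℝ} (hψ : ContDiff ℝ 1 ψ)
    (hspan : ∀ᶠ x in 𝓝 x₀, gradient ψ x ∈
      Submodule.span ℝ (range fun k => gradient (φ k) x)) :
    ∀ᶠ y in 𝓝 y₀, (∀ k, fderiv ℝ (φ k) x₀ (y - y₀) = 0) → ψ (T y) = ψ x₀ := by
  have hTd : ∀ᶠ y in 𝓝 y₀, DifferentiableAt ℝ T y :=
    (hT.eventually (by simp)).mono fun y hy => hy.differentiableAt one_ne_zero
  have hTc : Tendsto T (𝓝 y₀) (𝓝 x₀) := hT₀ ▸ hT.continuousAt.tendsto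
  obtain ⟨r, hr, hball⟩ := Metric.eventually_nhds_iff_ball.1
    (hTd.and (hφT.eventually_nhds.and (hTc.eventually hspan)))
  filter_upwards [Metric.ball_mem_nhds y₀ hr] with y hy hker
  have hseg : ∀ s ∈ Icc (0 : ℝ) 1, y₀ + s • (y - y₀) ∈ ball y₀ r := by
    intro s hs
    exact (convex_ball y₀ r).add_smul_sub_mem (mem_ball_self hr) hy hs
  have hline : ∀ s : ℝ, HasDerivAt (fun s : ℝ => y₀ + s • (y - y₀)) (y - y₀) s := by
    intro s
    simpa using ((hasDerivAt_id s).smul_const (y - y₀)).const_add y₀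
  have hder : ∀ s ∈ Icc (0 : ℝ) 1,
      HasDerivAt (fun s : ℝ => ψ (T (y₀ + s • (y - y₀)))) 0 s := by
    intro s hs
    obtain ⟨hTs, hφs, hsp⟩ := hball _ (hseg s hs)
    set z := y₀ + s • (y - y₀) with hz
    have hcomp : ∀ χ : E → ℝ, ContDiff ℝ 1 χ → HasFDerivAt (fun y => χ (T y))
        ((fderiv ℝ χ (T z)).comp (fderiv ℝ T z)) z := fun χ hχ =>
      (hasStrictFDerivAt_of_contDiff_one hχ (T z)).hasFDerivAt.comp z hTs.hasFDerivAt
    have h1 : ∀ k, fderiv ℝ (φ k) (T z) (fderiv ℝ T z (y - y₀)) = 0 := by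
      intro k
      have h2 : HasFDerivAt (fun y => φ k (T y)) (fderiv ℝ (φ k) x₀) z :=
        (fderiv ℝ (φ k) x₀).hasFDerivAt.congr_of_eventuallyEq
          (hφs.mono fun y hy => hy k)
      have h3 := DFunLike.congr_fun ((hcomp _ (hφ k)).unique h2) (y - y₀)
      rwa [ContinuousLinearMap.comp_apply, hker k] at h3
    have h4 : fderiv ℝ ψ (T z) (fderiv ℝ T z (y - y₀)) = 0 := by
      rw [← inner_gradient_left]
      refine Submodule.span_induction ?_ (by simp) ?_ ?_ hsp
      · rintro _ ⟨k, rfl⟩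
        simpa using h1 k
      · intro a b _ _ ha hb
        rw [inner_add_left, ha, hb, add_zero]
      · intro c a _ ha
        rw [real_inner_smul_left, ha, mul_zero]
    have h5 := (hcomp ψ hψ).comp_hasDerivAt s (hline s)
    rw [ContinuousLinearMap.comp_apply, h4] at h5
    exact h5
  have := constant_of_has_deriv_right_zero (a := 0) (b := 1)
    (fun s hs => (hder s hs).continuousAt.continuousWithinAt)
    (fun s hs => (hder s (Ico_subset_Icc_self hs)).hasDerivWithinAt) 1 (by simp)
  simpa [hT₀] using this

variable [Fintype β]

theorem contDiff_straighten (hφ : ∀ k, ContDiff ℝ 1 (φ k)) :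
    ContDiff ℝ 1 (straighten φ x₀ w) := by
  unfold straighten
  fun_prop

theorem hasFDerivAt_straighten (hφ : ∀ k, ContDiff ℝ 1 (φ k)) :
    HasFDerivAt (straighten φ x₀ w) (ContinuousLinearMap.id ℝ E) x₀ := by
  have h : ∀ k ∈ Finset.univ, HasFDerivAt
      (fun x => (φ k x - fderiv ℝ (φ k) x₀ x) • w k)
      ((fderiv ℝ (φ k) x₀ - fderiv ℝ (φ k) x₀).smulRight (w k)) x₀ :=
    fun k _ => ((hasStrictFDerivAt_of_contDiff_one (hφ k) x₀).hasFDerivAt.sub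
      (fderiv ℝ (φ k) x₀).hasFDerivAt).smul_const (w k)
  have h' := (hasFDerivAt_id x₀).fun_add (HasFDerivAt.fun_sum h)
  simp only [sub_self, ContinuousLinearMap.zero_smulRight, Finset.sum_const_zero, add_zero] at h'
  exact h'

theorem fderiv_apply_straighten [DecidableEq β]
    (hw : ∀ i j, fderiv ℝ (φ i) x₀ (w j) = if i = j then (1 : ℝ) else 0)
    (k : β) (x : E) :
    fderiv ℝ (φ k) x₀ (straighten φ x₀ w x) = φ k x := by
  simp [straighten, hw]

variable [FiniteDimensional ℝ E]

theorem exists_inverse_straighten [DecidableEq β] (hφ : ∀ k, ContDiff ℝ 1 (φ k))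
    (hw : ∀ i j, fderiv ℝ (φ i) x₀ (w j) = if i = j then (1 : ℝ) else 0) :
    ∃ T : E → E, ContDiffAt ℝ 1 T (straighten φ x₀ w x₀) ∧
      HasStrictFDerivAt T (ContinuousLinearMap.id ℝ E) (straighten φ x₀ w x₀) ∧
      T (straighten φ x₀ w x₀) = x₀ ∧
      (∀ᶠ x in 𝓝 x₀, T (straighten φ x₀ w x) = x) ∧
      ∀ᶠ y in 𝓝 (straighten φ x₀ w x₀), ∀ k, φ k (T y) = fderiv ℝ (φ k) x₀ y := by
  have hc := (contDiff_straighten hφ (x₀ := x₀) (w := w)).contDiffAt (x := x₀)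
  have hd : HasFDerivAt (straighten φ x₀ w)
      ((ContinuousLinearEquiv.refl ℝ E : E ≃L[ℝ] E) : E →L[ℝ] E) x₀ :=
    hasFDerivAt_straighten hφ
  have hs := hc.hasStrictFDerivAt' hd one_ne_zero
  refine ⟨hc.localInverse hd one_ne_zero, hc.to_localInverse hd one_ne_zero,
    hs.to_localInverse, hc.localInverse_apply_image hd one_ne_zero,
    hs.eventually_left_inverse, ?_⟩
  filter_upwards [hs.eventually_right_inverse] with y hy k
  rw [← fderiv_apply_straighten hw]
  exact congrArg _ hy

/-- The map `R` moves `x` to the common zero set of the `φ k` and then along `d`, a direction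
tangent to it. -/
theorem exists_curvilinear_retraction (hφ : ∀ k, ContDiff ℝ 1 (φ k)) (hφ₀ : ∀ k, φ k x₀ = 0)
    (hli : LinearIndependent ℝ fun k => gradient (φ k) x₀) {d : E}
    (hd : ∀ k, fderiv ℝ (φ k) x₀ d = 0) :
    ∃ (R : E × ℝ → E) (w : β → E),
      (∀ {F : Type} [NormedAddCommGroup F] [NormedSpace ℝ F] (ψ : E → F) (ψ' : E →L[ℝ] F),
        HasStrictFDerivAt ψ ψ' x₀ → ∀ η > 0, ∀ᶠ q : E × ℝ in 𝓝 (x₀, 0),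
          ‖ψ (R q) - ψ q.1 - ψ' (q.2 • d - ∑ k, φ k q.1 • w k)‖ ≤
            η * (∑ k, |φ k q.1| + |q.2|)) ∧
      (∃ C, 0 ≤ C ∧ ∀ᶠ q : E × ℝ in 𝓝 (x₀, 0), ‖R q - q.1‖ ≤ C * (∑ k, |φ k q.1| + |q.2|)) ∧
      ∀ ψ : E → ℝ, ContDiff ℝ 1 ψ → (∀ᶠ x in 𝓝 x₀, gradient ψ x ∈
          Submodule.span ℝ (range fun k => gradient (φ k) x)) →
        ∀ᶠ q : E × ℝ in 𝓝 (x₀, 0), ψ (R q) = ψ x₀ := by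
  classical
  obtain ⟨w, hw⟩ := exists_biorthogonal hli
  simp only [inner_gradient_left] at hw
  obtain ⟨T, hTc, hTs, hT₀, hTΘ, hφT⟩ := exists_inverse_straighten hφ hw
  set y₀ := straighten φ x₀ w x₀ with hy₀
  let Θ := straighten φ x₀ w
  have hΘc : Continuous Θ := (contDiff_straighten hφ).continuous
  let u : E × ℝ → E := fun q => q.2 • d - ∑ k, φ k q.1 • w k
  have hφc : ∀ k, Continuous (φ k) := fun k => (hφ k).continuous
  have huc : Continuous u := by fun_prop
  have hu₀ : u (x₀, 0) = 0 := by simp [u, hφ₀]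
  let M := ‖d‖ + ∑ k, ‖w k‖
  have hM : 0 ≤ M := by positivity
  have hu : ∀ q, ‖u q‖ ≤ M * (∑ k, |φ k q.1| + |q.2|) := by
    intro q
    have h1 : ‖∑ k, φ k q.1 • w k‖ ≤ (∑ k, ‖w k‖) * ∑ k, |φ k q.1| := by
      refine (norm_sum_le _ _).trans ?_
      rw [Finset.mul_sum]
      refine Finset.sum_le_sum fun k _ => ?_
      rw [norm_smul, mul_comm, Real.norm_eq_abs]
      gcongr
      exact Finset.single_le_sum (f := fun k => ‖w k‖) (fun _ _ => norm_nonneg _)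
        (Finset.mem_univ k)
    have h2 : ‖q.2 • d‖ = ‖d‖ * |q.2| := by rw [norm_smul, mul_comm, Real.norm_eq_abs]
    have h3 : 0 ≤ ‖d‖ * ∑ k, |φ k q.1| := by positivity
    have h4 : 0 ≤ (∑ k, ‖w k‖) * |q.2| := by positivity
    calc ‖u q‖ ≤ ‖q.2 • d‖ + ‖∑ k, φ k q.1 • w k‖ := norm_sub_le _ _
      _ ≤ M * (∑ k, |φ k q.1| + |q.2|) := by rw [h2]; simp only [M]; nlinarith
  have hpair : Tendsto (fun q : E × ℝ => (Θ q.1 + u q, Θ q.1)) (𝓝 (x₀, 0)) (𝓝 (y₀, y₀)) := by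
    have : Continuous fun q : E × ℝ => (Θ q.1 + u q, Θ q.1) := by fun_prop
    simpa [hu₀] using this.tendsto (x₀, 0)
  have hleft : ∀ᶠ q : E × ℝ in 𝓝 (x₀, 0), T (Θ q.1) = q.1 :=
    (continuous_fst.tendsto (x₀, (0 : ℝ))).eventually hTΘ
  have hexp : ∀ {F : Type} [NormedAddCommGroup F] [NormedSpace ℝ F] (ψ : E → F)
      (ψ' : E →L[ℝ] F), HasStrictFDerivAt ψ ψ' x₀ → ∀ η > 0, ∀ᶠ q : E × ℝ in 𝓝 (x₀, 0),
      ‖ψ (T (Θ q.1 + u q)) - ψ q.1 - ψ' (u q)‖ ≤ η * (∑ k, |φ k q.1| + |q.2|) := by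
    intro F _ _ ψ ψ' hψ η hη
    have h1 : HasStrictFDerivAt (fun y => ψ (T y)) ψ' y₀ := by
      have := HasStrictFDerivAt.comp y₀ (hT₀.symm ▸ hψ) hTs
      simpa using this
    filter_upwards [hpair.eventually (h1.isLittleO.bound (c := η / (M + 1)) (by positivity)),
      hleft] with q hq hl
    simp only [hl, add_sub_cancel_left] at hq
    refine hq.trans ?_
    calc η / (M + 1) * ‖u q‖ ≤ η / (M + 1) * (M * (∑ k, |φ k q.1| + |q.2|)) := by
          gcongr; exact hu q
      _ = η * (∑ k, |φ k q.1| + |q.2|) * (M / (M + 1)) := by ring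
      _ ≤ η * (∑ k, |φ k q.1| + |q.2|) * 1 := by
          gcongr
          rw [div_le_one (by positivity)]
          linarith
      _ = _ := mul_one _
  refine ⟨fun q => T (Θ q.1 + u q), w, hexp, ⟨M + M, by positivity, ?_⟩, ?_⟩
  · filter_upwards [hpair.eventually (hTs.isLittleO.bound (c := 1) one_pos), hleft] with q hq hl
    have h1 : ‖T (Θ q.1 + u q) - q.1 - u q‖ ≤ 1 * ‖u q‖ := by simpa [hl] using hq
    have h2 := norm_add_le (T (Θ q.1 + u q) - q.1 - u q) (u q)
    rw [sub_add_cancel] at h2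
    have h3 := hu q
    linarith
  · intro ψ hψ hspan
    have h1 := eventually_eq_of_gradient_mem_span hφ hTc hT₀ hφT hψ hspan
    filter_upwards [((continuous_fst.tendsto _).comp hpair).eventually h1] with q hq
    refine hq fun k => ?_
    have h2 : fderiv ℝ (φ k) x₀ (u q) = - φ k q.1 := by
      simp [u, hw, hd]
    simp [h2, Θ, hy₀, fderiv_apply_straighten hw, hφ₀]

end Straighten

section ErrorBound

variable {E : Type*} [NormedAddCommGroup E] [InnerProductSpace ℝ E]

section Combinations

variable {ι κ : Type*} [Fintype ι] [Fintype κ] {u : κ → E} {v : ι → E} {J : Set κ}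

theorem exists_strict_direction
    (hJ : ∀ i, i ∈ J ↔ ∃ (c : κ → ℝ) (ρ : ι → ℝ), (∀ j, 0 ≤ c j) ∧ c i = 0 ∧
      -u i = ∑ j, c j • u j + ∑ j, ρ j • v j) :
    ∃ d, (∀ j, inner ℝ (v j) d = 0) ∧ (∀ i ∈ J, inner ℝ (u i) d = 0) ∧
      ∀ i ∉ J, inner ℝ (u i) d < 0 := by
  classical
  have hsep : ∀ i, ∃ d, (∀ j, inner ℝ (v j) d = 0) ∧ (∀ j, inner ℝ (u j) d ≤ 0) ∧
      (i ∉ J → inner ℝ (u i) d < 0) := by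
    intro i
    by_cases hi : i ∈ J
    · exact ⟨0, by simp, by simp, fun h => absurd hi h⟩
    have hnot : ¬ ∀ x, (∀ t ∈ (Finset.univ : Finset (κ ⊕ ι ⊕ ι)),
        inner ℝ (Sum.elim (fun j => if j = i then 0 else u j) (Sum.elim v (-v)) t) x ≤ 0) →
        inner ℝ (-u i) x ≤ 0 := by
      intro hx
      obtain ⟨c, hc, hsum⟩ := exists_nonneg_combination_of_forall_inner_nonpos _ _ _ hx
      refine hi ((hJ i).2 ⟨fun j => if j = i then 0 else c (Sum.inl j),
        fun j => c (Sum.inr (Sum.inl j)) - c (Sum.inr (Sum.inr j)), fun j => ?_, by simp, ?_⟩)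
      · beta_reduce
        split_ifs
        exacts [le_rfl, hc _]
      · rw [hsum]
        simp only [Fintype.sum_sum_type, Sum.elim_inl, Sum.elim_inr, Pi.neg_apply, smul_neg,
          Finset.sum_neg_distrib, sub_smul, Finset.sum_sub_distrib, ite_smul, smul_ite, smul_zero,
          zero_smul]
        abel
    push Not at hnot
    obtain ⟨d, hd, hdi⟩ := hnot
    rw [inner_neg_left, neg_pos] at hdi
    refine ⟨d, fun j => le_antisymm ?_ ?_, fun j => ?_, fun _ => hdi⟩
    · simpa using hd (Sum.inr (Sum.inl j)) (Finset.mem_univ _)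
    · simpa using hd (Sum.inr (Sum.inr j)) (Finset.mem_univ _)
    · by_cases hji : j = i
      · exact hji ▸ hdi.le
      · simpa [hji] using hd (Sum.inl j) (Finset.mem_univ _)
  choose d hv hu hlt using hsep
  have hle : ∀ i, inner ℝ (u i) (∑ k, d k) ≤ 0 := fun i => by
    rw [inner_sum]
    exact Finset.sum_nonpos fun k _ => hu k i
  have hv' : ∀ j, inner ℝ (v j) (∑ k, d k) = 0 := fun j => by
    rw [inner_sum]
    exact Finset.sum_eq_zero fun k _ => hv k j
  refine ⟨∑ k, d k, hv', fun i hi => le_antisymm (hle i) ?_, fun i hi => ?_⟩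
  · obtain ⟨c, ρ, hc, -, hsum⟩ := (hJ i).1 hi
    have h1 := congrArg (fun y => inner ℝ y (∑ k, d k)) hsum
    simp only [inner_neg_left, inner_add_left, sum_inner, real_inner_smul_left, hv', mul_zero,
      Finset.sum_const_zero, add_zero] at h1
    have h2 : ∑ j, c j * inner ℝ (u j) (∑ k, d k) ≤ 0 :=
      Finset.sum_nonpos fun j _ => mul_nonpos_of_nonneg_of_nonpos (hc j) (hle j)
    linarith
  · rw [inner_sum]
    exact Finset.sum_neg' (fun k _ => hu k i) ⟨i, Finset.mem_univ _, hlt i hi⟩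

theorem exists_positive_combination_eq_zero
    (hJ : ∀ i, i ∈ J ↔ ∃ (c : κ → ℝ) (ρ : ι → ℝ), (∀ j, 0 ≤ c j) ∧ c i = 0 ∧
      -u i = ∑ j, c j • u j + ∑ j, ρ j • v j) :
    ∃ (c : κ → ℝ) (ρ : ι → ℝ), (∀ i ∈ J, 1 ≤ c i) ∧ (∀ i ∉ J, c i = 0) ∧
      ∑ i, c i • u i + ∑ j, ρ j • v j = 0 := by
  classical
  obtain ⟨d, hv, hz, hlt⟩ := exists_strict_direction hJ
  have hrel : ∀ i, ∃ (c : κ → ℝ) (ρ : ι → ℝ), (∀ j, 0 ≤ c j) ∧ (i ∈ J → 1 ≤ c i) ∧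
      (∀ j ∉ J, c j = 0) ∧ ∑ j, c j • u j + ∑ j, ρ j • v j = 0 := by
    intro i
    by_cases hi : i ∈ J
    · obtain ⟨c, ρ, hc, -, hsum⟩ := (hJ i).1 hi
      have h1 := congrArg (fun y => inner ℝ y d) hsum
      simp only [inner_neg_left, inner_add_left, sum_inner, real_inner_smul_left, hv, mul_zero,
        Finset.sum_const_zero, add_zero, hz i hi, neg_zero] at h1
      have hle : ∀ j, inner ℝ (u j) d ≤ 0 := fun j => by
        by_cases hj : j ∈ J
        exacts [(hz j hj).le, (hlt j hj).le]
      have h2 := (Finset.sum_eq_zero_iff_of_nonpos fun j _ =>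
        mul_nonpos_of_nonneg_of_nonpos (hc j) (hle j)).1 h1.symm
      refine ⟨c + Pi.single i 1, ρ, fun j => ?_, fun _ => ?_, fun j hj => ?_, ?_⟩
      · refine add_nonneg (hc j) ?_
        rw [Pi.single_apply]
        split_ifs <;> norm_num
      · simpa using hc i
      · have hji : j ≠ i := fun h => hj (h ▸ hi)
        simpa [hji] using (mul_eq_zero.1 (h2 j (Finset.mem_univ _))).resolve_right
          (hlt j hj).ne
      · have h3 : ∑ j, (Pi.single i 1 : κ → ℝ) j • u j = u i := by
          simp [Pi.single_apply, ite_smul]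
        simp only [Pi.add_apply, add_smul, Finset.sum_add_distrib, h3]
        rw [add_right_comm, ← hsum, neg_add_cancel]
    · exact ⟨0, 0, by simp, fun h => absurd h hi, by simp, by simp⟩
  choose c ρ hc hone hoff hsum using hrel
  refine ⟨∑ k, c k, ∑ k, ρ k, fun i hi => ?_, fun i hi => ?_, ?_⟩
  · rw [Finset.sum_apply]
    exact (hone i hi).trans (Finset.single_le_sum (f := fun k => c k i) (fun k _ => hc k i)
      (Finset.mem_univ i))
  · rw [Finset.sum_apply]
    exact Finset.sum_eq_zero fun k _ => hoff k i hi
  · simp only [Finset.sum_apply, Finset.sum_smul]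
    rw [Finset.sum_comm, Finset.sum_comm (s := (Finset.univ : Finset ι)),
      ← Finset.sum_add_distrib]
    exact Finset.sum_eq_zero fun k _ => hsum k

end Combinations

theorem sum_le_sum_of_injective {α β : Type*} [Fintype α] [Fintype β] {e : α → β}
    (he : Function.Injective e) {f : α → ℝ} {f' : β → ℝ} (hf' : ∀ b, 0 ≤ f' b)
    (hff' : ∀ a, f a ≤ f' (e a)) : ∑ a, f a ≤ ∑ b, f' b := by
  classical
  calc ∑ a, f a ≤ ∑ a, f' (e a) := Finset.sum_le_sum fun a _ => hff' a
    _ = ∑ b ∈ Finset.univ.image e, f' b := (Finset.sum_image fun _ _ _ _ h => he h).symm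
    _ ≤ ∑ b, f' b := Finset.sum_le_sum_of_subset_of_nonneg (Finset.subset_univ _)
        fun b _ _ => hf' b

variable [FiniteDimensional ℝ E]

theorem continuous_gradient_of_contDiff_one {ψ : E → ℝ} (hψ : ContDiff ℝ 1 ψ) :
    Continuous (gradient ψ) :=
  (InnerProductSpace.toDual ℝ E).symm.continuous.comp (hψ.continuous_fderiv one_ne_zero)

theorem exists_gradient_basis {τ : Type*} [Finite τ] {φ : τ → E → ℝ}
    (hφ : ∀ t, ContDiff ℝ 1 (φ t)) {x₀ : E}
    (hrank : ∀ᶠ x in 𝓝 x₀,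
      Module.finrank ℝ (Submodule.span ℝ (range fun t => gradient (φ t) x)) =
        Module.finrank ℝ (Submodule.span ℝ (range fun t => gradient (φ t) x₀))) :
    ∃ s : Set τ, LinearIndependent ℝ (fun k : s => gradient (φ k) x₀) ∧
      ∀ᶠ x in 𝓝 x₀, ∀ t, gradient (φ t) x ∈
        Submodule.span ℝ (range fun k : s => gradient (φ k) x) := by
  obtain ⟨s, -, hs, hsp, hli⟩ := exists_linearIndepOn_extension (K := ℝ)
    (v := fun t => gradient (φ t) x₀) (linearIndepOn_empty ℝ _) (Set.subset_univ ∅)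
  have hli : LinearIndependent ℝ (fun k : s => gradient (φ k) x₀) := hli
  have := Fintype.ofFinite s
  refine ⟨s, hli, ?_⟩
  have hcont : Continuous fun x => fun k : s => gradient (φ k) x :=
    continuous_pi fun k => continuous_gradient_of_contDiff_one (hφ k)
  have hspan₀ : Submodule.span ℝ (range fun k : s => gradient (φ k) x₀) =
      Submodule.span ℝ (range fun t => gradient (φ t) x₀) := by
    refine le_antisymm (Submodule.span_mono ?_) (Submodule.span_le.2 ?_)
    · rintro _ ⟨k, rfl⟩
      exact ⟨k, rfl⟩
    · rwa [image_univ, image_eq_range] at hsp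
  filter_upwards [hrank, (hcont.tendsto x₀).eventually
    (isOpen_setOfPred_linearIndependent.mem_nhds hli)] with x hx hlix t
  have hle : Submodule.span ℝ (range fun k : s => gradient (φ k) x) ≤
      Submodule.span ℝ (range fun t => gradient (φ t) x) := by
    refine Submodule.span_mono ?_
    rintro _ ⟨k, rfl⟩
    exact ⟨k, rfl⟩
  rw [Submodule.eq_of_le_of_finrank_eq hle (by
    rw [hx, ← hspan₀, finrank_span_eq_card hlix, finrank_span_eq_card hli])]
  exact Submodule.subset_span ⟨t, rfl⟩

theorem gradient_sum_add_sum {ι κ : Type*} [Fintype ι] [Fintype κ] {g : κ → E → ℝ}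
    {h : ι → E → ℝ} (hg : ∀ i, ContDiff ℝ 1 (g i)) (hh : ∀ j, ContDiff ℝ 1 (h j))
    (c : κ → ℝ) (ρ : ι → ℝ) (x : E) :
    gradient (fun x => ∑ i, c i * g i x + ∑ j, ρ j * h j x) x =
      ∑ i, c i • gradient (g i) x + ∑ j, ρ j • gradient (h j) x := by
  have h1 := (HasFDerivAt.fun_sum (u := Finset.univ) fun i _ =>
      (hasStrictFDerivAt_of_contDiff_one (hg i) x).hasFDerivAt.const_mul (c i)).fun_add
    (HasFDerivAt.fun_sum (u := Finset.univ) fun j _ =>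
      (hasStrictFDerivAt_of_contDiff_one (hh j) x).hasFDerivAt.const_mul (ρ j))
  unfold gradient
  rw [h1.fderiv]
  simp

/-- A nonlinear constraint system whose equality-like gradients have locally constant rank (the
constant rank of the subspace component condition) admits a local error bound. -/
theorem exists_local_error_bound {ι κ : Type*} [Fintype ι] [Fintype κ] {g : κ → E → ℝ}
    {h : ι → E → ℝ} (hg : ∀ i, ContDiff ℝ 1 (g i)) (hh : ∀ j, ContDiff ℝ 1 (h j)) {x₀ : E}
    (hg₀ : ∀ i, g i x₀ = 0) (hh₀ : ∀ j, h j x₀ = 0) {J : Set κ}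
    (hJ : ∀ i, i ∈ J ↔ ∃ (c : κ → ℝ) (ρ : ι → ℝ), (∀ j, 0 ≤ c j) ∧ c i = 0 ∧
      -gradient (g i) x₀ = ∑ j, c j • gradient (g j) x₀ + ∑ j, ρ j • gradient (h j) x₀)
    (hrank : ∀ᶠ x in 𝓝 x₀, Module.finrank ℝ (Submodule.span ℝ
        ((fun i => gradient (g i) x) '' J ∪ range fun j => gradient (h j) x)) =
      Module.finrank ℝ (Submodule.span ℝ
        ((fun i => gradient (g i) x₀) '' J ∪ range fun j => gradient (h j) x₀))) :
    ∃ C, 0 ≤ C ∧ ∀ᶠ x in 𝓝 x₀, ∃ z, (∀ i, g i z ≤ 0) ∧ (∀ j, h j z = 0) ∧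
      ‖z - x‖ ≤ C * (∑ i, max (g i x) 0 + ∑ j, |h j x|) := by
  classical
  let φ : J ⊕ ι → E → ℝ := Sum.elim (fun i => g i) h
  have hφ : ∀ t, ContDiff ℝ 1 (φ t) := by
    rintro (i | j)
    exacts [hg i, hh j]
  have hφ₀ : ∀ t, φ t x₀ = 0 := by
    rintro (i | j)
    exacts [hg₀ i, hh₀ j]
  have hrange : ∀ x, (fun i => gradient (g i) x) '' J ∪ range (fun j => gradient (h j) x) =
      range fun t => gradient (φ t) x := by
    intro x
    rw [image_eq_range, ← Set.Sum.elim_range]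
    congr 1
    ext1 (i | j) <;> rfl
  obtain ⟨s, hli, hspan⟩ := exists_gradient_basis hφ
    (hrank.mono fun x hx => by rwa [hrange x, hrange x₀] at hx)
  obtain ⟨d, hdh, hdJ, hdlt⟩ := exists_strict_direction hJ
  obtain ⟨c, ρ, hc1, hc0, hcomb⟩ := exists_positive_combination_eq_zero hJ
  simp only [inner_gradient_left] at hdh hdJ hdlt
  have hdφ : ∀ t, fderiv ℝ (φ t) x₀ d = 0 := by
    rintro (i | j)
    exacts [hdJ i i.2, hdh j]
  obtain ⟨R, w, hexp, ⟨M, hM, hRM⟩, hconst⟩ :=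
    exists_curvilinear_retraction (φ := fun k : s => φ k) (fun k => hφ k) (fun k => hφ₀ k) hli
      (fun k => hdφ k)
  let N : E → ℝ := fun x => ∑ k : s, |φ k x|
  let r : E → ℝ := fun x => ∑ i, max (g i x) 0 + ∑ j, |h j x|
  have hN0 : ∀ x, 0 ≤ N x := fun x => Finset.sum_nonneg fun _ _ => abs_nonneg _
  have hr0 : ∀ x, 0 ≤ r x := fun x => add_nonneg
    (Finset.sum_nonneg fun _ _ => le_max_right _ _) (Finset.sum_nonneg fun _ _ => abs_nonneg _)
  have hgr : ∀ i x, max (g i x) 0 ≤ r x := fun i x =>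
    (Finset.single_le_sum (f := fun i => max (g i x) 0) (fun _ _ => le_max_right _ _)
      (Finset.mem_univ i)).trans (le_add_of_nonneg_right
        (Finset.sum_nonneg fun _ _ => abs_nonneg _))
  have hhr : ∀ j x, |h j x| ≤ r x := fun j x =>
    (Finset.single_le_sum (f := fun j => |h j x|) (fun _ _ => abs_nonneg _)
      (Finset.mem_univ j)).trans (le_add_of_nonneg_left
        (Finset.sum_nonneg fun _ _ => le_max_right _ _))
  have hcnn : ∀ i, 0 ≤ c i := fun i => by
    by_cases hi : i ∈ J
    exacts [zero_le_one.trans (hc1 i hi), (hc0 i hi).ge]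
  have hNr : ∃ K, 0 ≤ K ∧ ∀ᶠ x in 𝓝 x₀, N x ≤ K * r x := by
    let ψ : E → ℝ := fun x => ∑ i, c i * g i x + ∑ j, ρ j * h j x
    have hψ : ContDiff ℝ 1 ψ := by fun_prop
    have hψ₀ : ψ x₀ = 0 := by simp [ψ, hg₀, hh₀]
    have hψd : HasStrictFDerivAt ψ (0 : E →L[ℝ] ℝ) x₀ := by
      have h1 := hasStrictFDerivAt_of_contDiff_one hψ x₀
      have h2 : gradient ψ x₀ = 0 := (gradient_sum_add_sum hg hh c ρ x₀).trans hcomb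
      have h3 : fderiv ℝ ψ x₀ = 0 := by simpa [gradient] using h2
      rwa [h3] at h1
    have hψs : ∀ᶠ x in 𝓝 x₀, gradient ψ x ∈
        Submodule.span ℝ (range fun k : s => gradient (φ k) x) := by
      filter_upwards [hspan] with x hx
      rw [gradient_sum_add_sum hg hh c ρ x]
      refine add_mem (sum_mem fun i _ => ?_)
        (sum_mem fun j _ => Submodule.smul_mem _ _ (hx (Sum.inr j)))
      by_cases hi : i ∈ J
      · exact Submodule.smul_mem _ _ (hx (Sum.inl ⟨i, hi⟩))
      · simp [hc0 i hi]
    have hin : Tendsto (fun x : E => (x, (0 : ℝ))) (𝓝 x₀) (𝓝 (x₀, 0)) :=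
      (Continuous.prodMk_left (0 : ℝ)).tendsto x₀
    refine ⟨2 * (∑ i, 2 * c i + ∑ j, (|ρ j| + 1)), mul_nonneg zero_le_two (add_nonneg
      (Finset.sum_nonneg fun i _ => mul_nonneg zero_le_two (hcnn i)) (by positivity)), ?_⟩
    filter_upwards [hin.eventually (hexp ψ 0 hψd (1 / 2) (by norm_num)),
      hin.eventually (hconst ψ hψ hψs)] with x hx1 hx2
    have h1 : |ψ x| ≤ 1 / 2 * N x := by simpa [hx2, hψ₀, N] using hx1
    have h2 : N x ≤ ∑ i, c i * |g i x| + ∑ j, |h j x| := by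
      let e : J ⊕ ι → κ ⊕ ι := Sum.map Subtype.val id
      have he : Function.Injective fun k : s => e k :=
        (Subtype.val_injective.sumMap Function.injective_id).comp Subtype.val_injective
      have := sum_le_sum_of_injective he (f := fun k : s => |φ k x|)
        (f' := Sum.elim (fun i => c i * |g i x|) fun j => |h j x|)
        (by
          rintro (i | j)
          exacts [mul_nonneg (hcnn i) (abs_nonneg _), abs_nonneg _])
        (by
          rintro ⟨i | j, _⟩
          · simpa [φ, e] using le_mul_of_one_le_left (abs_nonneg (g i x)) (hc1 i i.2)
          · simp [φ, e])
      simpa [Fintype.sum_sum_type] using this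
    have h3 : ∑ i, c i * |g i x| = ∑ i, 2 * c i * max (g i x) 0 - ∑ i, c i * g i x := by
      rw [← Finset.sum_sub_distrib]
      refine Finset.sum_congr rfl fun i _ => ?_
      rcases le_total 0 (g i x) with hi | hi
      · rw [abs_of_nonneg hi, max_eq_left hi]; ring
      · rw [abs_of_nonpos hi, max_eq_right hi]; ring
    have h4 : ∑ i, 2 * c i * max (g i x) 0 ≤ (∑ i, 2 * c i) * r x := by
      rw [Finset.sum_mul]
      exact Finset.sum_le_sum fun i _ => mul_le_mul_of_nonneg_left (hgr i x)
        (mul_nonneg zero_le_two (hcnn i))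
    have h5 : ∑ j, ρ j * h j x + ∑ j, |h j x| ≤ (∑ j, (|ρ j| + 1)) * r x := by
      rw [← Finset.sum_add_distrib, Finset.sum_mul]
      refine Finset.sum_le_sum fun j _ => ?_
      have h6 : ρ j * h j x ≤ |ρ j| * |h j x| := (le_abs_self _).trans (abs_mul _ _).le
      have h7 : (|ρ j| + 1) * |h j x| ≤ (|ρ j| + 1) * r x := by
        gcongr
        exact hhr j x
      linarith
    have h8 := (abs_le.1 h1).1
    have h9 : ψ x = ∑ i, c i * g i x + ∑ j, ρ j * h j x := rfl
    linarith
  obtain ⟨K, hK, hNK⟩ := hNr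
  have hstep : ∀ i, ∃ B, 0 ≤ B ∧ ∀ᶠ q : E × ℝ in 𝓝 (x₀, 0),
      B * (r q.1 + N q.1) ≤ q.2 → g i (R q) ≤ 0 := by
    intro i
    by_cases hi : i ∈ J
    · refine ⟨0, le_rfl, ?_⟩
      filter_upwards [hconst (g i) (hg i) (hspan.mono fun x hx => hx (Sum.inl ⟨i, hi⟩))]
        with q hq _
      rw [hq, hg₀]
    set D := fderiv ℝ (g i) x₀ with hD
    let W := ∑ k, |D (w k)|
    have hW : 0 ≤ W := Finset.sum_nonneg fun _ _ => abs_nonneg _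
    set σ := - D d with hσ
    have hσ0 : 0 < σ := neg_pos.2 (hdlt i hi)
    refine ⟨2 / σ * (1 + W + σ / 2), by positivity, ?_⟩
    filter_upwards [hexp (g i) D (hasStrictFDerivAt_of_contDiff_one (hg i) x₀) (σ / 2)
      (by positivity)] with q hq hBq
    have hrN : 0 ≤ r q.1 + N q.1 := add_nonneg (hr0 _) (hN0 _)
    have hq0 : 0 ≤ q.2 := le_trans (by positivity) hBq
    have h1 := (le_abs_self _).trans hq
    rw [abs_of_nonneg hq0, map_sub, map_smul, map_sum, smul_eq_mul] at h1
    simp only [map_smul, smul_eq_mul] at h1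
    have h2 : -∑ k : s, φ k q.1 * D (w k) ≤ W * N q.1 := by
      rw [← Finset.sum_neg_distrib, Finset.mul_sum]
      refine Finset.sum_le_sum fun k _ => ?_
      calc -(φ k q.1 * D (w k)) ≤ |φ k q.1| * |D (w k)| := by
            rw [← abs_mul]; exact neg_le_abs _
        _ ≤ |φ k q.1| * W := by
            gcongr
            exact Finset.single_le_sum (f := fun k => |D (w k)|) (fun _ _ => abs_nonneg _)
              (Finset.mem_univ k)
        _ = W * |φ k q.1| := mul_comm _ _
    have h3 : g i q.1 ≤ r q.1 := (le_max_left _ _).trans (hgr i _)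
    have h4 : (1 + W + σ / 2) * (r q.1 + N q.1) ≤ σ / 2 * q.2 := by
      have := mul_le_mul_of_nonneg_left hBq (by positivity : 0 ≤ σ / 2)
      calc _ = σ / 2 * (2 / σ * (1 + W + σ / 2) * (r q.1 + N q.1)) := by field_simp
        _ ≤ _ := this
    have h5 : 0 ≤ (W + σ / 2) * r q.1 := mul_nonneg (by positivity) (hr0 _)
    have h6 : D d = -σ := by rw [hσ, neg_neg]
    rw [h6] at h1
    change g i (R q) - g i q.1 - (q.2 * -σ - ∑ k : s, φ k q.1 * D (w k)) ≤
      σ / 2 * (N q.1 + q.2) at h1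
    nlinarith [hN0 q.1]
  choose B hB hBev using hstep
  let t : E → ℝ := fun x => (∑ i, B i) * (r x + N x)
  have hBs : 0 ≤ ∑ i, B i := Finset.sum_nonneg fun i _ => hB i
  have ht0 : ∀ x, 0 ≤ t x := fun x => mul_nonneg hBs (add_nonneg (hr0 x) (hN0 x))
  have hgc : ∀ i, Continuous (g i) := fun i => (hg i).continuous
  have hhc : ∀ j, Continuous (h j) := fun j => (hh j).continuous
  have hφc : ∀ k, Continuous (φ k) := fun k => (hφ k).continuous
  have htend : Tendsto (fun x => (x, t x)) (𝓝 x₀) (𝓝 (x₀, 0)) := by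
    have hcont : Continuous fun x => (x, t x) := by fun_prop
    have : t x₀ = 0 := by simp [t, r, N, hg₀, hh₀, hφ₀]
    simpa [this] using hcont.tendsto x₀
  have hh' : ∀ j, ∀ᶠ q : E × ℝ in 𝓝 (x₀, 0), h j (R q) = h j x₀ := fun j =>
    hconst (h j) (hh j) (hspan.mono fun x hx => hx (Sum.inr j))
  refine ⟨M * (K + (∑ i, B i) * (1 + K)), by positivity, ?_⟩
  filter_upwards [hNK, htend.eventually hRM, htend.eventually (eventually_all.2 hBev),
    htend.eventually (eventually_all.2 hh')] with x hx1 hx2 hx3 hx4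
  refine ⟨R (x, t x), fun i => hx3 i ?_, fun j => (hx4 j).trans (hh₀ j), hx2.trans ?_⟩
  · exact mul_le_mul_of_nonneg_right (Finset.single_le_sum (fun i _ => hB i) (Finset.mem_univ i))
      (add_nonneg (hr0 x) (hN0 x))
  · change M * (N x + |t x|) ≤ _ * r x
    rw [abs_of_nonneg (ht0 x), mul_assoc M]
    refine mul_le_mul_of_nonneg_left ?_ hM
    have := mul_le_mul_of_nonneg_left hx1 hBs
    simp only [t]
    nlinarith

end ErrorBound

section Switching

theorem sum_subtype_eq_sum_of_forall_notMem {α M : Type*} [Fintype α] [AddCommMonoid M]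
    (S : Set α) [Fintype S] {f : α → M} (hf : ∀ a ∉ S, f a = 0) :
    ∑ a : S, f a = ∑ a, f a :=
  Fintype.sum_of_injective Subtype.val Subtype.val_injective _ _ (by simpa using hf) fun _ => rfl

variable {g : Fin m → Vec n → ℝ} {h : Fin p → Vec n → ℝ} {G H : Fin l → Vec n → ℝ} {xb : Vec n}

open scoped Classical in
theorem mem_igMinus_iff {β1 β2 : Set (Fin l)} (i : Ig g xb) :
    (i : Fin m) ∈ IgMinus g h G H xb β1 β2 ↔ ∃ (c : Ig g xb → ℝ)
      (ρ : Fin p ⊕ ↥(IG G H xb ∪ β1) ⊕ ↥(IH G H xb ∪ β2) → ℝ), (∀ j, 0 ≤ c j) ∧ c i = 0 ∧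
      -gradient (g i) xb = ∑ j, c j • gradient (g j) xb +
        ∑ j, ρ j • gradient (Sum.elim h (Sum.elim (fun k : ↥(IG G H xb ∪ β1) => G k)
          fun k : ↥(IH G H xb ∪ β2) => H k) j) xb := by
  constructor
  · rintro ⟨-, c, ρ, μ, ν, hc, hcoff, hμ, hν, hsum⟩
    refine ⟨fun j => c j, Sum.elim ρ (Sum.elim (fun k => μ k) fun k => ν k), fun j => hc j,
      hcoff _ (by simp), ?_⟩
    simp only [Fintype.sum_sum_type, Sum.elim_inl, Sum.elim_inr]
    rw [sum_subtype_eq_sum_of_forall_notMem (Ig g xb) (f := fun j => c j • gradient (g j) xb),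
      sum_subtype_eq_sum_of_forall_notMem _ (f := fun k => μ k • gradient (G k) xb),
      sum_subtype_eq_sum_of_forall_notMem _ (f := fun k => ν k • gradient (H k) xb), hsum]
    · simp only [add_assoc]
    · exact fun k hk => by rw [hν k hk, zero_smul]
    · exact fun k hk => by rw [hμ k hk, zero_smul]
    · exact fun k hk => by rw [hcoff k fun h => hk h.1, zero_smul]
  · rintro ⟨c, ρ, hc, hci, hsum⟩
    have hoff : ∀ {α : Type} (S : Set α) (c : S → ℝ) (a : α), a ∉ S →
        Function.extend Subtype.val c 0 a = 0 := fun S c a ha =>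
      Function.extend_apply' _ _ _ (by rintro ⟨b, rfl⟩; exact ha b.2)
    refine ⟨i.2, Function.extend Subtype.val c 0, fun j => ρ (Sum.inl j),
      Function.extend Subtype.val (fun k => ρ (Sum.inr (Sum.inl k))) 0,
      Function.extend Subtype.val (fun k => ρ (Sum.inr (Sum.inr k))) 0, fun j => ?_, fun j hj => ?_,
      hoff _ _, hoff _ _, ?_⟩
    · by_cases hj : j ∈ Ig g xb
      · exact (hc ⟨j, hj⟩).trans_eq (Subtype.val_injective.extend_apply c 0 ⟨j, hj⟩).symm
      · exact (hoff _ c j hj).ge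
    · by_cases hji : j = i
      · rw [hji, Subtype.val_injective.extend_apply, hci]
      · exact hoff _ c j fun h => hj ⟨h, hji⟩
    · rw [hsum, ← sum_subtype_eq_sum_of_forall_notMem (Ig g xb)
          (f := fun j => Function.extend Subtype.val c 0 j • gradient (g j) xb),
        ← sum_subtype_eq_sum_of_forall_notMem (IG G H xb ∪ β1),
        ← sum_subtype_eq_sum_of_forall_notMem (IH G H xb ∪ β2)]
      · simp only [Fintype.sum_sum_type, Sum.elim_inl, Sum.elim_inr,
          Subtype.val_injective.extend_apply, add_assoc]
      · exact fun k hk => by rw [hoff _ _ k hk, zero_smul]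
      · exact fun k hk => by rw [hoff _ _ k hk, zero_smul]
      · exact fun k hk => by rw [hoff _ _ k hk, zero_smul]

theorem max_le_residual (i : Fin m) (x : Vec n) : max (g i x) 0 ≤ residual g h G H x := by
  refine Real.le_sqrt_of_sq_le ?_
  have h1 := Finset.single_le_sum (f := fun i => max (g i x) 0 ^ 2) (fun _ _ => sq_nonneg _)
    (Finset.mem_univ i)
  have h2 : 0 ≤ ∑ j, h j x ^ 2 := by positivity
  have h3 : 0 ≤ ∑ k, min (G k x ^ 2) (H k x ^ 2) := by positivity
  linarith

theorem abs_le_residual (j : Fin p) (x : Vec n) : |h j x| ≤ residual g h G H x := by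
  refine Real.le_sqrt_of_sq_le ?_
  rw [sq_abs]
  have h1 := Finset.single_le_sum (f := fun j => h j x ^ 2) (fun _ _ => sq_nonneg _)
    (Finset.mem_univ j)
  have h2 : 0 ≤ ∑ i, max (g i x) 0 ^ 2 := by positivity
  have h3 : 0 ≤ ∑ k, min (G k x ^ 2) (H k x ^ 2) := by positivity
  linarith

theorem le_residual_of_sq_le_min {k : Fin l} {x : Vec n} {a : ℝ}
    (ha : a ^ 2 ≤ min (G k x ^ 2) (H k x ^ 2)) : a ≤ residual g h G H x := by
  refine Real.le_sqrt_of_sq_le ?_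
  have h1 := Finset.single_le_sum (f := fun k => min (G k x ^ 2) (H k x ^ 2))
    (fun _ _ => le_min (sq_nonneg _) (sq_nonneg _)) (Finset.mem_univ k)
  have h2 : 0 ≤ ∑ i, max (g i x) 0 ^ 2 := by positivity
  have h3 : 0 ≤ ∑ j, h j x ^ 2 := by positivity
  linarith

theorem residual_nonneg (x : Vec n) : 0 ≤ residual g h G H x := Real.sqrt_nonneg _

theorem residual_eq_zero_of_mem_feas (hxb : xb ∈ Feas g h G H) : residual g h G H xb = 0 := by
  obtain ⟨hg, hh, hGH⟩ := hxb
  have h1 : ∀ k, min (G k xb ^ 2) (H k xb ^ 2) = 0 := fun k => by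
    rcases mul_eq_zero.1 (hGH k) with hk | hk <;> simp [hk, sq_nonneg]
  simp [residual, h1, hh, max_eq_right (hg _)]

theorem eventually_exists_branchFeas (hg : ∀ i, ContDiff ℝ 1 (g i)) (hh : ∀ j, ContDiff ℝ 1 (h j))
    (hG : ∀ k, ContDiff ℝ 1 (G k)) (hH : ∀ k, ContDiff ℝ 1 (H k)) (hxb : xb ∈ Feas g h G H)
    (hcq : PCRSC g h G H xb) {β1 β2 : Set (Fin l)} (hβ : Partition G H xb β1 β2) :
    ∃ C, 0 ≤ C ∧ ∀ᶠ x in 𝓝 xb, (∀ k ∈ IG G H xb ∪ β1, G k x ^ 2 ≤ H k x ^ 2) →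
      (∀ k ∈ IH G H xb ∪ β2, H k x ^ 2 ≤ G k x ^ 2) → ∃ z, (∀ i ∈ Ig g xb, g i z ≤ 0) ∧
      (∀ j, h j z = 0) ∧ (∀ k ∈ IG G H xb ∪ β1, G k z = 0) ∧ (∀ k ∈ IH G H xb ∪ β2, H k z = 0) ∧
      ‖z - x‖ ≤ C * residual g h G H x := by
  classical
  have hβ1 : ∀ k ∈ IG G H xb ∪ β1, G k xb = 0 := by
    rintro k (hk | hk)
    exacts [hk.1, (hβ.2 ▸ Or.inl hk : k ∈ IGH G H xb).1]
  have hβ2 : ∀ k ∈ IH G H xb ∪ β2, H k xb = 0 := by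
    rintro k (hk | hk)
    exacts [hk.2, (hβ.2 ▸ Or.inr hk : k ∈ IGH G H xb).2]
  let φ : Fin p ⊕ ↥(IG G H xb ∪ β1) ⊕ ↥(IH G H xb ∪ β2) → Vec n → ℝ :=
    Sum.elim h (Sum.elim (fun k => G k) fun k => H k)
  have hspan : ∀ x, (fun i : Ig g xb => gradient (g i) x) ''
        {i | (i : Fin m) ∈ IgMinus g h G H xb β1 β2} ∪ range (fun j => gradient (φ j) x) =
      (fun i => gradient (g i) x) '' IgMinus g h G H xb β1 β2 ∪
        range (fun j => gradient (h j) x) ∪ (fun k => gradient (G k) x) '' (IG G H xb ∪ β1) ∪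
        (fun k => gradient (H k) x) '' (IH G H xb ∪ β2) := by
    intro x
    ext y
    constructor
    · rintro (⟨i, hi, rfl⟩ | ⟨j | k | k, rfl⟩)
      · exact Or.inl (Or.inl (Or.inl ⟨i, hi, rfl⟩))
      · exact Or.inl (Or.inl (Or.inr ⟨j, rfl⟩))
      · exact Or.inl (Or.inr ⟨k, k.2, rfl⟩)
      · exact Or.inr ⟨k, k.2, rfl⟩
    · rintro (((⟨i, hi, rfl⟩ | ⟨j, rfl⟩) | ⟨k, hk, rfl⟩) | ⟨k, hk, rfl⟩)
      · exact Or.inl ⟨⟨i, hi.1⟩, hi, rfl⟩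
      · exact Or.inr ⟨Sum.inl j, rfl⟩
      · exact Or.inr ⟨Sum.inr (Sum.inl ⟨k, hk⟩), rfl⟩
      · exact Or.inr ⟨Sum.inr (Sum.inr ⟨k, hk⟩), rfl⟩
  obtain ⟨ε, hε, hrank⟩ := hcq β1 β2 hβ
  obtain ⟨C, hC, hev⟩ := exists_local_error_bound (g := fun i : Ig g xb => g i) (h := φ)
    (J := {i | (i : Fin m) ∈ IgMinus g h G H xb β1 β2}) (x₀ := xb) (fun i => hg i)
    (by
      rintro (j | k | k)
      exacts [hh j, hG k, hH k])
    (fun i => i.2)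
    (by
      rintro (j | k | k)
      exacts [hxb.2.1 j, hβ1 k k.2, hβ2 k k.2])
    mem_igMinus_iff
    (by
      filter_upwards [ball_mem_nhds xb hε] with x hx
      rw [hspan x, hspan xb]
      exact hrank x (mem_ball_iff_norm.1 hx))
  refine ⟨C * (Fintype.card (Ig g xb) +
    Fintype.card (Fin p ⊕ ↥(IG G H xb ∪ β1) ⊕ ↥(IH G H xb ∪ β2))), by positivity, ?_⟩
  filter_upwards [hev] with x ⟨z, hzg, hzφ, hzx⟩ hx1 hx2
  refine ⟨z, fun i hi => hzg ⟨i, hi⟩, fun j => hzφ (Sum.inl j),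
    fun k hk => hzφ (Sum.inr (Sum.inl ⟨k, hk⟩)), fun k hk => hzφ (Sum.inr (Sum.inr ⟨k, hk⟩)),
    hzx.trans ?_⟩
  rw [mul_assoc, add_mul, ← nsmul_eq_mul, ← nsmul_eq_mul]
  refine mul_le_mul_of_nonneg_left (add_le_add
    (Finset.sum_le_card_nsmul _ _ _ fun i _ => max_le_residual (i : Fin m) x)
    (Finset.sum_le_card_nsmul _ _ _ fun j _ => ?_)) hC
  obtain j | k | k := j
  · exact abs_le_residual j x
  · exact le_residual_of_sq_le_min (k := k) (by
      rw [sq_abs]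
      exact le_min le_rfl (hx1 k k.2))
  · exact le_residual_of_sq_le_min (k := k) (by
      rw [sq_abs]
      exact le_min (hx2 k k.2) le_rfl)

/-- Local error bound for the feasible set of a program with switching constraints. -/
theorem exists_feas_error_bound (hg : ∀ i, ContDiff ℝ 1 (g i)) (hh : ∀ j, ContDiff ℝ 1 (h j))
    (hG : ∀ k, ContDiff ℝ 1 (G k)) (hH : ∀ k, ContDiff ℝ 1 (H k)) (hxb : xb ∈ Feas g h G H)
    (hcq : PCRSC g h G H xb) :
    ∃ C, 0 ≤ C ∧ ∀ U ∈ 𝓝 xb, ∀ᶠ x in 𝓝 xb, ∃ z ∈ Feas g h G H, z ∈ U ∧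
      ‖z - x‖ ≤ C * residual g h G H x := by
  have hbr : ∀ β : Set (Fin l), ∃ C, 0 ≤ C ∧ ∀ᶠ x in 𝓝 xb,
      (∀ k ∈ IG G H xb ∪ IGH G H xb ∩ β, G k x ^ 2 ≤ H k x ^ 2) →
      (∀ k ∈ IH G H xb ∪ IGH G H xb \ β, H k x ^ 2 ≤ G k x ^ 2) → ∃ z,
      (∀ i ∈ Ig g xb, g i z ≤ 0) ∧ (∀ j, h j z = 0) ∧
      (∀ k ∈ IG G H xb ∪ IGH G H xb ∩ β, G k z = 0) ∧
      (∀ k ∈ IH G H xb ∪ IGH G H xb \ β, H k z = 0) ∧ ‖z - x‖ ≤ C * residual g h G H x :=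
    fun β => eventually_exists_branchFeas hg hh hG hH hxb hcq
      ⟨disjoint_iff_inter_eq_empty.1 (disjoint_sdiff_right.inter_left' _), inter_union_sdiff _ _⟩
  choose C hC hev using hbr
  have hgc : ∀ i, Continuous (g i) := fun i => (hg i).continuous
  have hhc : ∀ j, Continuous (h j) := fun j => (hh j).continuous
  have hGc : ∀ k, Continuous (G k) := fun k => (hG k).continuous
  have hHc : ∀ k, Continuous (H k) := fun k => (hH k).continuous
  have hres : Continuous (residual g h G H) := by
    unfold residual
    fun_prop
  have hC' : 0 ≤ ∑ β, C β := Finset.sum_nonneg fun β _ => hC β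
  refine ⟨∑ β, C β, hC', fun U hU => ?_⟩
  have hinact : ∀ᶠ z in 𝓝 xb, ∀ i ∉ Ig g xb, g i z < 0 :=
    eventually_all.2 fun i => eventually_imp_distrib_left.2 fun hi =>
      (hgc i).tendsto xb |>.eventually_lt_const ((hxb.1 i).lt_of_ne hi)
  obtain ⟨δ, hδ, hball⟩ := Metric.mem_nhds_iff.1 (inter_mem hU hinact)
  have hsmall : ∀ᶠ x in 𝓝 xb, ‖x - xb‖ + (∑ β, C β) * residual g h G H x < δ := by
    have hcont : Continuous fun x => ‖x - xb‖ + (∑ β, C β) * residual g h G H x := by fun_prop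
    refine (hcont.tendsto xb).eventually_lt_const ?_
    simpa [residual_eq_zero_of_mem_feas hxb] using hδ
  have hIG : ∀ᶠ x in 𝓝 xb, ∀ k ∈ IG G H xb, G k x ^ 2 < H k x ^ 2 :=
    eventually_all.2 fun k => eventually_imp_distrib_left.2 fun hk =>
      (((hGc k).pow 2).tendsto xb).eventually_lt (((hHc k).pow 2).tendsto xb)
        (by simpa [hk.1] using sq_pos_of_ne_zero hk.2)
  have hIH : ∀ᶠ x in 𝓝 xb, ∀ k ∈ IH G H xb, H k x ^ 2 < G k x ^ 2 :=
    eventually_all.2 fun k => eventually_imp_distrib_left.2 fun hk =>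
      (((hHc k).pow 2).tendsto xb).eventually_lt (((hGc k).pow 2).tendsto xb)
        (by simpa [hk.2] using sq_pos_of_ne_zero hk.1)
  filter_upwards [eventually_all.2 hev, hsmall, hIG, hIH] with x hx hxδ hxG hxH
  let β := {k | G k x ^ 2 ≤ H k x ^ 2}
  obtain ⟨z, hzg, hzh, hzG, hzH, hzx⟩ := hx β
    (by
      rintro k (hk | hk)
      exacts [(hxG k hk).le, hk.2])
    (by
      rintro k (hk | hk)
      exacts [(hxH k hk).le, (not_le.1 hk.2).le])
  have hzx' : ‖z - x‖ ≤ (∑ β, C β) * residual g h G H x := hzx.trans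
    (mul_le_mul_of_nonneg_right (Finset.single_le_sum (fun β _ => hC β) (Finset.mem_univ β))
      (residual_nonneg x))
  have hzδ : z ∈ ball xb δ := by
    rw [mem_ball_iff_norm]
    linarith [norm_sub_le_norm_sub_add_norm_sub z x xb]
  refine ⟨z, ⟨fun i => ?_, hzh, fun k => ?_⟩, (hball hzδ).1, hzx'⟩
  · by_cases hi : i ∈ Ig g xb
    exacts [hzg i hi, ((hball hzδ).2 i hi).le]
  · by_cases hGk : G k xb = 0
    · by_cases hHk : H k xb = 0
      · by_cases hk : k ∈ β
        · rw [hzG k (Or.inr ⟨⟨hGk, hHk⟩, hk⟩), zero_mul]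
        · rw [hzH k (Or.inr ⟨⟨hGk, hHk⟩, hk⟩), mul_zero]
      · rw [hzG k (Or.inl ⟨hGk, hHk⟩), zero_mul]
    · rw [hzH k (Or.inl ⟨hGk, (mul_eq_zero.1 (hxb.2.2 k)).resolve_left hGk⟩), mul_zero]

end Switching

theorem pcrsc_implies_exact_penalty {n m p l : ℕ} (f : Vec n → ℝ) (g : Fin m → Vec n → ℝ)
    (h : Fin p → Vec n → ℝ) (G H : Fin l → Vec n → ℝ)
    (hf : ContDiff ℝ 2 f) (hg : ∀ i, ContDiff ℝ 2 (g i)) (hh : ∀ j, ContDiff ℝ 2 (h j))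
    (hG : ∀ k, ContDiff ℝ 2 (G k)) (hH : ∀ k, ContDiff ℝ 2 (H k))
    (xb : Vec n) (hxb : xb ∈ Feas g h G H)
    (hopt : LocallyOptimal f g h G H xb)
    (hcq : PCRSC g h G H xb) :
    ∃ κbar > (0:ℝ), ∀ κ : ℝ, κbar < κ →
      ∃ ε' > (0:ℝ), ∀ x : Vec n, ‖x - xb‖ < ε' →
        Pen f g h G H κ xb ≤ Pen f g h G H κ x := by
  obtain ⟨C, hC, hbound⟩ := exists_feas_error_bound (fun i => (hg i).of_le one_le_two)
    (fun j => (hh j).of_le one_le_two) (fun k => (hG k).of_le one_le_two)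
    (fun k => (hH k).of_le one_le_two) hxb hcq
  obtain ⟨K, V, hV, hlip⟩ := (hf.of_le one_le_two).contDiffAt (x := xb) |>.exists_lipschitzOnWith
  obtain ⟨-, ε, hε, hmin⟩ := hopt
  refine ⟨K * C + 1, by positivity, fun κ hκ => ?_⟩
  obtain ⟨ε', hε', hball⟩ := Metric.mem_nhds_iff.1
    (inter_mem (hbound _ (inter_mem hV (ball_mem_nhds xb hε))) hV)
  refine ⟨ε', hε', fun x hx => ?_⟩
  obtain ⟨⟨z, hz, ⟨hzV, hzε⟩, hzx⟩, hxV⟩ := hball (mem_ball_iff_norm.2 hx)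
  have h1 := hmin z hz (mem_ball_iff_norm.1 hzε)
  have h2 := (le_abs_self _).trans (hlip.norm_sub_le hzV hxV)
  have h3 := mul_le_mul_of_nonneg_left hzx K.coe_nonneg
  have h4 := residual_nonneg (g := g) (h := h) (G := G) (H := H) x
  have h5 := mul_le_mul_of_nonneg_right hκ.le h4
  rw [Pen, Pen, residual_eq_zero_of_mem_feas hxb, mul_zero, add_zero]
  linarith

end MPSC
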